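/- With the discrete Fourier setup and the coefficients A_{pq}^{rs} defined from the symmetric kernel modes B̂, one has for all p,q,r,s ∈ K the closed-form expression A_{pq}^{rs} = 1_N(r+s−p−q) · N^{−2d} · Σ_{i,j∈K} B̂(i,j) ω^{−i·(p−s)} ω^{−j·(q−s)}. -/

import Mathlib

open scoped BigOperators

noncomputable section

/-- The finite set of Fourier modes `K = {k ∈ ℤ^d : |k_i| ≤ n}`. -/
def K (d n : ℕ) : Finset (Fin d → ℤ) := Fintype.piFinset fun _ => Finset.Icc (-(n : ℤ)) n

/-- Integer dot product on `ℤ^d`. -/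
def dotZ {d : ℕ} (k p : Fin d → ℤ) : ℤ := ∑ i, k i * p i

/-- The root of unity power `ω^a = exp(2πi a / N)`. -/
def ω (N : ℕ) (a : ℤ) : ℂ := Complex.exp (2 * Real.pi * Complex.I * a / N)

/-- The indicator `1_N(l)`, equal to `1` if `l ≡ 0 (mod N)` componentwise and `0` otherwise. -/
def indN (N : ℕ) {d : ℕ} (l : Fin d → ℤ) : ℂ := if ∀ i, (N : ℤ) ∣ l i then 1 else 0

/-- The symmetric modulo map: the unique element of `K d n` congruent to `l` modulo `N = 2n+1`
componentwise. -/
def smod (n : ℕ) {d : ℕ} (l : Fin d → ℤ) : Fin d → ℤ :=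
  fun i => (l i + n) % (2 * n + 1) - n

/-- Discrete Fourier coefficients `F̂_k = N^{-d} Σ_{p ∈ K} F_p ω^{-k·p}`. -/
def Fhat (d n : ℕ) (F : (Fin d → ℤ) → ℂ) (k : Fin d → ℤ) : ℂ :=
  ((2 * n + 1 : ℂ) ^ d)⁻¹ * ∑ p ∈ K d n, F p * ω (2 * n + 1) (-(dotZ k p))

/-- The discrete-velocity-method coefficients `A_{pq}^{rs}` obtained from the kernel modes `B̂`. -/
def Acoef (d n : ℕ) (Bh : (Fin d → ℤ) → (Fin d → ℤ) → ℂ) (p q r s : Fin d → ℤ) : ℂ :=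
  ((2 * n + 1 : ℂ) ^ (3 * d))⁻¹ *
    ∑ l ∈ K d n, ∑ m ∈ K d n, ∑ k ∈ K d n, ∑ j ∈ K d n,
      indN (2 * n + 1) (l + m - k - j) * Bh (smod n (l - j)) (smod n (m - j)) *
        ω (2 * n + 1) (-(dotZ l p)) * ω (2 * n + 1) (-(dotZ m q)) *
        ω (2 * n + 1) (dotZ k r) * ω (2 * n + 1) (dotZ j s)

theorem ω_add (N : ℕ) (a b : ℤ) : ω N (a + b) = ω N a * ω N b := by
  rw [ω, ω, ω, ← Complex.exp_add]
  congr 1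
  push_cast
  ring

theorem ω_eq_one_iff {N : ℕ} (hN : N ≠ 0) (a : ℤ) : ω N a = 1 ↔ (N : ℤ) ∣ a := by
  have hN' : (N : ℂ) ≠ 0 := by exact_mod_cast hN
  rw [ω, Complex.exp_eq_one_iff]
  refine exists_congr fun c => ?_
  rw [div_eq_iff hN', ← @Int.cast_inj ℂ]
  have hpi := Complex.two_pi_I_ne_zero
  constructor
  · intro h
    apply mul_left_cancel₀ hpi
    push_cast
    linear_combination h
  · intro h
    push_cast at h
    linear_combination (2 * Real.pi * Complex.I) * h

theorem ω_congr {N : ℕ} (hN : N ≠ 0) {a b : ℤ} (h : (N : ℤ) ∣ a - b) : ω N a = ω N b := by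
  rw [← sub_add_cancel a b, ω_add, (ω_eq_one_iff hN _).2 h, one_mul]

section dotZ

variable {d : ℕ}

theorem dotZ_add_left (a b p : Fin d → ℤ) : dotZ (a + b) p = dotZ a p + dotZ b p := by
  simp [dotZ, add_mul, Finset.sum_add_distrib]

theorem dotZ_sub_left (a b p : Fin d → ℤ) : dotZ (a - b) p = dotZ a p - dotZ b p := by
  simp [dotZ, sub_mul, Finset.sum_sub_distrib]

theorem dotZ_neg_neg (a p : Fin d → ℤ) : dotZ (-a) (-p) = dotZ a p := by
  simp [dotZ]

theorem dotZ_add_right (a p q : Fin d → ℤ) : dotZ a (p + q) = dotZ a p + dotZ a q := by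
  simp [dotZ, mul_add, Finset.sum_add_distrib]

theorem dotZ_sub_right (a p q : Fin d → ℤ) : dotZ a (p - q) = dotZ a p - dotZ a q := by
  simp [dotZ, mul_sub, Finset.sum_sub_distrib]

theorem dvd_dotZ_of_left {N : ℤ} {a : Fin d → ℤ} (h : ∀ i, N ∣ a i) (p : Fin d → ℤ) :
    N ∣ dotZ a p :=
  Finset.dvd_sum fun i _ => (h i).mul_right _

theorem dvd_dotZ_of_right {N : ℤ} {p : Fin d → ℤ} (h : ∀ i, N ∣ p i) (a : Fin d → ℤ) :
    N ∣ dotZ a p :=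
  Finset.dvd_sum fun i _ => (h i).mul_left _

end dotZ

section smod

variable {d n : ℕ}

theorem mem_K {k : Fin d → ℤ} : k ∈ K d n ↔ ∀ i, -(n : ℤ) ≤ k i ∧ k i ≤ n := by
  simp [K]

theorem neg_mem_K {k : Fin d → ℤ} (hk : k ∈ K d n) : -k ∈ K d n := by
  rw [mem_K] at *
  intro i
  have := hk i
  simp only [Pi.neg_apply]
  omega

theorem card_K (d n : ℕ) : (K d n).card = (2 * n + 1) ^ d := by
  rw [K, Fintype.card_piFinset_const, Int.card_Icc]
  congr 1
  omega

theorem smod_mem_K (n : ℕ) (l : Fin d → ℤ) : smod n l ∈ K d n := by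
  rw [mem_K]
  intro i
  have h0 := Int.emod_nonneg (l i + n) (b := 2 * n + 1) (by omega)
  have h1 := Int.emod_lt_of_pos (l i + n) (b := 2 * n + 1) (by omega)
  simp only [smod]
  omega

theorem dvd_smod_sub (n : ℕ) (l : Fin d → ℤ) (i : Fin d) :
    ((2 * n + 1 : ℕ) : ℤ) ∣ smod n l i - l i := by
  refine ⟨-((l i + n) / (2 * n + 1)), ?_⟩
  have := Int.emod_add_mul_ediv (l i + n) (2 * n + 1)
  simp only [smod]
  push_cast
  linarith

theorem smod_congr {a b : Fin d → ℤ} (h : ∀ i, ((2 * n + 1 : ℕ) : ℤ) ∣ a i - b i) :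
    smod n a = smod n b := by
  funext i
  have hi := h i
  push_cast at hi
  have : (a i + n) % (2 * n + 1 : ℤ) = (b i + n) % (2 * n + 1) :=
    Int.emod_eq_emod_iff_emod_sub_eq_zero.2 (Int.emod_eq_zero_of_dvd (by simpa using hi))
  simp only [smod, this]

theorem smod_of_mem_K {k : Fin d → ℤ} (hk : k ∈ K d n) : smod n k = k := by
  funext i
  have := mem_K.1 hk i
  simp only [smod]
  rw [Int.emod_eq_of_lt (by omega) (by omega)]
  ring

theorem eq_of_mem_K {a b : Fin d → ℤ} (ha : a ∈ K d n) (hb : b ∈ K d n)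
    (h : ∀ i, ((2 * n + 1 : ℕ) : ℤ) ∣ a i - b i) : a = b := by
  rw [← smod_of_mem_K ha, ← smod_of_mem_K hb, smod_congr h]

end smod

/-- A function on `ℤ^d` that is periodic modulo `N` in each component. -/
def PeriodicMod (N : ℕ) {d : ℕ} (f : (Fin d → ℤ) → ℂ) : Prop :=
  ∀ a b : Fin d → ℤ, (∀ i, (N : ℤ) ∣ a i - b i) → f a = f b

section sums

variable {d n : ℕ}

theorem periodicMod_ω_dotZ {N : ℕ} (hN : N ≠ 0) (t : Fin d → ℤ) :
    PeriodicMod N fun a => ω N (dotZ a t) := fun a b h =>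
  ω_congr hN (by rw [← dotZ_sub_left]; exact dvd_dotZ_of_left h t)

theorem PeriodicMod.mul {N : ℕ} {f g : (Fin d → ℤ) → ℂ} (hf : PeriodicMod N f)
    (hg : PeriodicMod N g) : PeriodicMod N fun a => f a * g a := fun a b h => by
  simp only [hf a b h, hg a b h]

theorem PeriodicMod.sum_K_add {f : (Fin d → ℤ) → ℂ} (hf : PeriodicMod (2 * n + 1) f)
    (c : Fin d → ℤ) : ∑ l ∈ K d n, f (l + c) = ∑ l ∈ K d n, f l := by
  refine Finset.sum_bij' (fun l _ => smod n (l + c)) (fun l _ => smod n (l - c))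
    (fun _ _ => smod_mem_K _ _) (fun _ _ => smod_mem_K _ _) ?_ ?_ ?_
  · intro l hl
    refine eq_of_mem_K (smod_mem_K _ _) hl fun i => ?_
    have h := dvd_add (dvd_smod_sub n (smod n (l + c) - c) i) (dvd_smod_sub n (l + c) i)
    simp only [Pi.sub_apply, Pi.add_apply] at h
    rwa [show ∀ x y : ℤ, x - (y - c i) + (y - (l i + c i)) = x - l i by intros; ring] at h
  · intro l hl
    refine eq_of_mem_K (smod_mem_K _ _) hl fun i => ?_
    have h := dvd_add (dvd_smod_sub n (smod n (l - c) + c) i) (dvd_smod_sub n (l - c) i)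
    simp only [Pi.sub_apply, Pi.add_apply] at h
    rwa [show ∀ x y : ℤ, x - (y + c i) + (y - (l i - c i)) = x - l i by intros; ring] at h
  · intro l _
    exact (hf _ _ (dvd_smod_sub n (l + c))).symm

theorem PeriodicMod.sum_K_indN {f : (Fin d → ℤ) → ℂ} (hf : PeriodicMod (2 * n + 1) f)
    (c : Fin d → ℤ) : ∑ k ∈ K d n, indN (2 * n + 1) (c - k) * f k = f c := by
  rw [Finset.sum_eq_single_of_mem (smod n c) (smod_mem_K n c)]
  · have h : ∀ i, ((2 * n + 1 : ℕ) : ℤ) ∣ (c - smod n c) i := fun i =>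
      (dvd_sub_comm).1 (dvd_smod_sub n c i)
    rw [indN, if_pos h, one_mul, hf _ _ (dvd_smod_sub n c)]
  · intro k hk hne
    rw [indN, if_neg, zero_mul]
    exact fun h => hne (by rw [← smod_of_mem_K hk, smod_congr h])

theorem sum_K_ω_dotZ (t : Fin d → ℤ) :
    ∑ j ∈ K d n, ω (2 * n + 1) (dotZ j t) = (2 * n + 1 : ℂ) ^ d * indN (2 * n + 1) t := by
  have hN : 2 * n + 1 ≠ 0 := by omega
  by_cases h : ∀ i, ((2 * n + 1 : ℕ) : ℤ) ∣ t i
  · rw [indN, if_pos h, Finset.sum_congr rfl fun j _ =>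
      (ω_eq_one_iff hN _).2 (dvd_dotZ_of_right h j)]
    simp [card_K]
  · rw [indN, if_neg h, mul_zero]
    obtain ⟨i, hi⟩ := not_forall.1 h
    have hshift := (periodicMod_ω_dotZ hN t).sum_K_add (n := n) (Pi.single i 1)
    have hsingle : dotZ (Pi.single i 1) t = t i := by simp [dotZ, Pi.single_apply]
    simp only [dotZ_add_left, ω_add, hsingle, ← Finset.sum_mul] at hshift
    by_contra hne
    exact hi ((ω_eq_one_iff hN _).1 (mul_left_cancel₀ hne (hshift.trans (mul_one _).symm)))

theorem sum_K_neg (f : (Fin d → ℤ) → ℂ) : ∑ l ∈ K d n, f (-l) = ∑ l ∈ K d n, f l :=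
  Finset.sum_bij' (fun l _ => -l) (fun l _ => -l) (fun _ => neg_mem_K) (fun _ => neg_mem_K)
    (fun _ _ => neg_neg _) (fun _ _ => neg_neg _) fun _ _ => rfl

/-- Eliminating `k` by the constraint `l + m ≡ k + j` and translating `l`, `m` by `j` decouples
the sum over `j` from the kernel modes. -/
theorem sum_modes_eq (Bh : (Fin d → ℤ) → (Fin d → ℤ) → ℂ) (p q r s : Fin d → ℤ) :
    ∑ l ∈ K d n, ∑ m ∈ K d n, ∑ k ∈ K d n, ∑ j ∈ K d n,
      indN (2 * n + 1) (l + m - k - j) * Bh (smod n (l - j)) (smod n (m - j)) *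
        ω (2 * n + 1) (-(dotZ l p)) * ω (2 * n + 1) (-(dotZ m q)) *
        ω (2 * n + 1) (dotZ k r) * ω (2 * n + 1) (dotZ j s)
      = (∑ j ∈ K d n, ω (2 * n + 1) (dotZ j (r + s - p - q))) *
          ∑ l ∈ K d n, ∑ m ∈ K d n,
            Bh l m * ω (2 * n + 1) (dotZ l (r - p)) * ω (2 * n + 1) (dotZ m (r - q)) := by
  have hN : 2 * n + 1 ≠ 0 := by omega
  have helim (l m j : Fin d → ℤ) : ∑ k ∈ K d n,
      indN (2 * n + 1) (l + m - k - j) * Bh (smod n (l - j)) (smod n (m - j)) *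
        ω (2 * n + 1) (-(dotZ l p)) * ω (2 * n + 1) (-(dotZ m q)) *
        ω (2 * n + 1) (dotZ k r) * ω (2 * n + 1) (dotZ j s)
      = Bh (smod n (l - j)) (smod n (m - j)) * ω (2 * n + 1) (dotZ l (r - p)) *
          ω (2 * n + 1) (dotZ m (r - q)) * ω (2 * n + 1) (dotZ j (s - r)) := by
    have h := (periodicMod_ω_dotZ hN r).sum_K_indN (n := n) (l + m - j)
    calc _ = Bh (smod n (l - j)) (smod n (m - j)) * ω (2 * n + 1) (-(dotZ l p)) *
            ω (2 * n + 1) (-(dotZ m q)) * ω (2 * n + 1) (dotZ j s) *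
            ∑ k ∈ K d n, indN (2 * n + 1) (l + m - j - k) * ω (2 * n + 1) (dotZ k r) := by
          rw [Finset.mul_sum]
          refine Finset.sum_congr rfl fun k _ => ?_
          rw [sub_right_comm]
          ring
      _ = _ := by
          rw [h]
          simp only [dotZ_sub_left, dotZ_add_left, dotZ_sub_right]
          simp only [sub_eq_add_neg, ω_add]
          ring
  have hper (j t : Fin d → ℤ) (g : (Fin d → ℤ) → ℂ) : PeriodicMod (2 * n + 1)
      fun l => g (smod n (l - j)) * ω (2 * n + 1) (dotZ l t) :=
    PeriodicMod.mul (fun a b h => by rw [smod_congr (b := b - j)]; simpa using h)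
      (periodicMod_ω_dotZ hN t)
  have hshift (j : Fin d → ℤ) : ∑ l ∈ K d n, ∑ m ∈ K d n,
      Bh (smod n (l - j)) (smod n (m - j)) * ω (2 * n + 1) (dotZ l (r - p)) *
          ω (2 * n + 1) (dotZ m (r - q)) * ω (2 * n + 1) (dotZ j (s - r))
      = ω (2 * n + 1) (dotZ j (r + s - p - q)) * ∑ l ∈ K d n, ∑ m ∈ K d n,
          Bh l m * ω (2 * n + 1) (dotZ l (r - p)) * ω (2 * n + 1) (dotZ m (r - q)) := by
    calc _ = (∑ l ∈ K d n, (∑ m ∈ K d n, Bh (smod n (l - j)) (smod n (m - j)) *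
              ω (2 * n + 1) (dotZ m (r - q))) * ω (2 * n + 1) (dotZ l (r - p))) *
            ω (2 * n + 1) (dotZ j (s - r)) := by
          simp only [Finset.sum_mul]
          exact Finset.sum_congr rfl fun l _ => Finset.sum_congr rfl fun m _ => by ring
      _ = (∑ l ∈ K d n, (∑ m ∈ K d n, Bh l m *
              ω (2 * n + 1) (dotZ (m + j) (r - q))) * ω (2 * n + 1) (dotZ (l + j) (r - p))) *
            ω (2 * n + 1) (dotZ j (s - r)) := by
          rw [← (hper j (r - p) fun x => ∑ m ∈ K d n, Bh x (smod n (m - j)) *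
              ω (2 * n + 1) (dotZ m (r - q))).sum_K_add j]
          congr 1
          refine Finset.sum_congr rfl fun l hl => ?_
          rw [add_sub_cancel_right, smod_of_mem_K hl, ← (hper j (r - q) (Bh l)).sum_K_add j]
          congr 1
          refine Finset.sum_congr rfl fun m hm => ?_
          rw [add_sub_cancel_right, smod_of_mem_K hm]
      _ = _ := by
          have hj : dotZ j (r + s - p - q) =
              dotZ j (r - q) + dotZ j (r - p) + dotZ j (s - r) := by
            rw [← dotZ_add_right, ← dotZ_add_right]
            congr 1
            abel
          simp only [hj, dotZ_add_left, ω_add, Finset.mul_sum, Finset.sum_mul]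
          exact Finset.sum_congr rfl fun l _ => Finset.sum_congr rfl fun m _ => by ring
  rw [Finset.sum_mul, ← Finset.sum_congr rfl fun j _ => hshift j]
  refine Eq.trans ?_ Finset.sum_comm
  refine Finset.sum_congr rfl fun l _ => Eq.trans ?_ Finset.sum_comm
  refine Finset.sum_congr rfl fun m _ => Finset.sum_comm.trans ?_
  exact Finset.sum_congr rfl fun j _ => helim l m j

end sums

/-- Closed-form expression for the coefficients `A_{pq}^{rs}`. -/
theorem Acoef_closed_form (d n : ℕ) (hd : 1 ≤ d) (hn : 1 ≤ n)
    (Bh : (Fin d → ℤ) → (Fin d → ℤ) → ℂ)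
    (hsym1 : ∀ l ∈ K d n, ∀ m ∈ K d n, Bh l m = Bh m l)
    (hsym2 : ∀ l ∈ K d n, ∀ m ∈ K d n, Bh l m = Bh l (-m))
    (p q r s : Fin d → ℤ) (hp : p ∈ K d n) (hq : q ∈ K d n)
    (hr : r ∈ K d n) (hs : s ∈ K d n) :
    Acoef d n Bh p q r s
      = indN (2 * n + 1) (r + s - p - q) * ((2 * n + 1 : ℂ) ^ (2 * d))⁻¹ *
          ∑ i ∈ K d n, ∑ j ∈ K d n,
            Bh i j * ω (2 * n + 1) (-(dotZ i (p - s))) * ω (2 * n + 1) (-(dotZ j (q - s))) := by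
  have hN : 2 * n + 1 ≠ 0 := by omega
  have hN' : (2 * n + 1 : ℂ) ≠ 0 := by exact_mod_cast hN
  have hneg : ∀ l ∈ K d n, ∀ m ∈ K d n, Bh (-l) (-m) = Bh m l := fun l hl m hm => by
    rw [← hsym2 _ (neg_mem_K hl) _ hm, hsym1 _ (neg_mem_K hl) _ hm, ← hsym2 _ hm _ hl]
  rw [Acoef, sum_modes_eq, sum_K_ω_dotZ]
  by_cases h : ∀ i, ((2 * n + 1 : ℕ) : ℤ) ∣ (r + s - p - q) i
  · have hphase (a x y : Fin d → ℤ) (hxy : x + y = r + s - p - q) :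
        ω (2 * n + 1) (dotZ a x) = ω (2 * n + 1) (-(dotZ a y)) := by
      refine ω_congr hN ?_
      rw [sub_neg_eq_add, ← dotZ_add_right, hxy]
      exact dvd_dotZ_of_right h a
    have hsum : ∑ l ∈ K d n, ∑ m ∈ K d n,
          Bh l m * ω (2 * n + 1) (dotZ l (r - p)) * ω (2 * n + 1) (dotZ m (r - q))
        = ∑ i ∈ K d n, ∑ j ∈ K d n,
            Bh i j * ω (2 * n + 1) (-(dotZ i (p - s))) * ω (2 * n + 1) (-(dotZ j (q - s))) := by
      rw [← sum_K_neg, Finset.sum_comm, ← sum_K_neg]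
      refine Finset.sum_congr rfl fun i hi => Finset.sum_congr rfl fun j hj => ?_
      rw [hneg j hj i hi, hphase (-j) (r - p) (s - q) (by abel),
        hphase (-i) (r - q) (s - p) (by abel), ← neg_sub q s, ← neg_sub p s,
        dotZ_neg_neg, dotZ_neg_neg]
      ring
    rw [hsum, show 3 * d = 2 * d + d by ring, pow_add]
    field_simp
  · rw [indN, if_neg h]
    simp
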